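/- arXiv:0803.2999 — 2 statements merged into one kernel-verified Lean document; each statement's English description precedes it below -/
import Mathlib

section
/- Let a < b be real numbers, let g: [0,1] → [a,b] be twice continuously differentiable, and let f: [a,b] → ℝ be Borel measurable with ∫_a^b f(z)² dz < ∞. Then ∫_0^1 f[g(y)]² g'(y)² dy ≤ ( 2·sup_{y∈[0,1]} |g'(y)| + ∫_0^1 |g''(y)| dy ) · ∫_a^b f(z)² dz. -/
open MeasureTheory

/-- Integrating by parts with a primitive of `h` bounds the weighted composition. -/
lemma integral_comp_mul_deriv_sq_le {a b s t M : ℝ} (hst : s ≤ t)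
    {g g' g'' h : ℝ → ℝ}
    (hg' : ∀ y ∈ Set.Icc s t, HasDerivAt g (g' y) y)
    (hg'' : ∀ y ∈ Set.Icc s t, HasDerivAt g' (g'' y) y)
    (hg''c : ContinuousOn g'' (Set.Icc s t))
    (hM : ∀ y ∈ Set.Icc s t, |g' y| ≤ M)
    (hrange : ∀ y ∈ Set.Icc s t, g y ∈ Set.Icc a b)
    (hc : Continuous h) (h0 : ∀ z, 0 ≤ h z) :
    ∫ y in s..t, h (g y) * g' y ^ 2 ≤
      (2 * M + ∫ y in s..t, |g'' y|) * ∫ z in a..b, h z := by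
  set H : ℝ → ℝ := fun z => ∫ w in a..z, h w with hH
  have hgc : ContinuousOn g (Set.Icc s t) := fun y hy => (hg' y hy).continuousAt.continuousWithinAt
  have hg'c : ContinuousOn g' (Set.Icc s t) :=
    fun y hy => (hg'' y hy).continuousAt.continuousWithinAt
  have hHd (z : ℝ) : HasDerivAt H (h z) z := hc.integral_hasStrictDerivAt a z |>.hasDerivAt
  have hH0 : ∀ y ∈ Set.Icc s t, 0 ≤ H (g y) := fun y hy =>
    intervalIntegral.integral_nonneg (hrange y hy).1 fun z _ => h0 z
  have hHb : ∀ y ∈ Set.Icc s t, H (g y) ≤ H b := fun y hy =>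
    intervalIntegral.integral_mono_interval le_rfl (hrange y hy).1 (hrange y hy).2
      (Filter.Eventually.of_forall h0) (hc.intervalIntegrable _ _)
  have hHc : Continuous H := continuous_iff_continuousAt.2 fun z => (hHd z).continuousAt
  have hHgc : ContinuousOn (fun y => H (g y)) (Set.Icc s t) := hHc.comp_continuousOn hgc
  have hs := Set.left_mem_Icc.2 hst
  have ht := Set.right_mem_Icc.2 hst
  have ibp := intervalIntegral.integral_mul_deriv_eq_deriv_mul (a := s) (b := t)
    (u := g') (u' := g'') (v := fun y => H (g y)) (v' := fun y => h (g y) * g' y)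
    (by rwa [Set.uIcc_of_le hst])
    (by rw [Set.uIcc_of_le hst]; exact fun y hy => (hHd (g y)).comp y (hg' y hy))
    (hg''c.intervalIntegrable_of_Icc hst)
    (((hc.comp_continuousOn hgc).mul hg'c).intervalIntegrable_of_Icc hst)
  have hend : ∀ y ∈ Set.Icc s t, |g' y * H (g y)| ≤ M * H b := fun y hy => by
    rw [abs_mul, abs_of_nonneg (hH0 y hy)]
    exact mul_le_mul (hM y hy) (hHb y hy) (hH0 y hy) ((abs_nonneg _).trans (hM y hy))
  have hrem : -∫ y in s..t, g'' y * H (g y) ≤ (∫ y in s..t, |g'' y|) * H b := by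
    rw [← intervalIntegral.integral_neg, ← intervalIntegral.integral_mul_const]
    refine intervalIntegral.integral_mono_on hst
      ((hg''c.mul hHgc).neg.intervalIntegrable_of_Icc hst)
      ((hg''c.abs.mul continuousOn_const).intervalIntegrable_of_Icc hst) fun y hy => ?_
    calc -(g'' y * H (g y)) ≤ |g'' y| * H (g y) := by
          rw [← neg_mul]
          exact mul_le_mul_of_nonneg_right (neg_le_abs _) (hH0 y hy)
      _ ≤ |g'' y| * H b := mul_le_mul_of_nonneg_left (hHb y hy) (abs_nonneg _)
  calc ∫ y in s..t, h (g y) * g' y ^ 2 = ∫ y in s..t, g' y * (h (g y) * g' y) := by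
        congr 1; ext y; ring
    _ ≤ (2 * M + ∫ y in s..t, |g'' y|) * H b := by
        rw [ibp]
        linarith [(abs_le.1 (hend t ht)).2, (abs_le.1 (hend s hs)).1]

/-- A finite measure is dominated by another one as soon as its integrals of bounded continuous
nonnegative functions are. -/
lemma MeasureTheory.Measure.le_of_forall_lintegral_le {X : Type*} [TopologicalSpace X]
    [MeasurableSpace X] [BorelSpace X] [HasOuterApproxClosed X] {μ ν : Measure X}
    [IsFiniteMeasure μ] [IsFiniteMeasure ν] [μ.WeaklyRegular]
    (h : ∀ φ : BoundedContinuousFunction X NNReal, ∫⁻ x, φ x ∂μ ≤ ∫⁻ x, φ x ∂ν) : μ ≤ ν := by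
  refine Measure.le_iff.2 fun A hA => ?_
  rw [hA.measure_eq_iSup_isClosed_of_ne_top (measure_ne_top μ A)]
  refine iSup₂_le fun F hFA => iSup_le fun hF => le_trans ?_ (measure_mono hFA)
  exact le_of_tendsto_of_tendsto' (HasOuterApproxClosed.tendsto_lintegral_apprSeq hF μ)
    (HasOuterApproxClosed.tendsto_lintegral_apprSeq hF ν) fun n => h _

/-- Corrected form of inequality (39): for a twice continuously differentiable `g : [0,1] → [a,b]`
and square-integrable `f` on `[a,b]`,
`∫₀¹ f(g(y))² g'(y)² dy ≤ (2 sup_{[0,1]}|g'| + ∫₀¹ |g''|) · ∫_a^b f(z)² dz`. -/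
theorem composition_L2_bound
    (a b : ℝ) (hab : a < b)
    (g g' g'' : ℝ → ℝ)
    (hg' : ∀ y ∈ Set.Icc (0 : ℝ) 1, HasDerivAt g (g' y) y)
    (hg'' : ∀ y ∈ Set.Icc (0 : ℝ) 1, HasDerivAt g' (g'' y) y)
    (hg''c : ContinuousOn g'' (Set.Icc 0 1))
    (hrange : ∀ y ∈ Set.Icc (0 : ℝ) 1, g y ∈ Set.Icc a b)
    (f : ℝ → ℝ) (hf : Measurable f)
    (hf2 : IntegrableOn (fun z => f z ^ 2) (Set.Icc a b)) :
    ∫ y in Set.Icc (0 : ℝ) 1, f (g y) ^ 2 * g' y ^ 2 ≤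
      (2 * sSup ((fun y => |g' y|) '' Set.Icc 0 1) + ∫ y in Set.Icc (0 : ℝ) 1, |g'' y|) *
        ∫ z in Set.Icc a b, f z ^ 2 := by
  set M := sSup ((fun y => |g' y|) '' Set.Icc 0 1)
  set C := 2 * M + ∫ y in Set.Icc (0 : ℝ) 1, |g'' y| with hC
  have hgc : ContinuousOn g (Set.Icc 0 1) := fun y hy => (hg' y hy).continuousAt.continuousWithinAt
  have hg'c : ContinuousOn g' (Set.Icc 0 1) :=
    fun y hy => (hg'' y hy).continuousAt.continuousWithinAt
  have hM : ∀ y ∈ Set.Icc (0 : ℝ) 1, |g' y| ≤ M := fun y hy =>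
    le_csSup (isCompact_Icc.bddAbove_image hg'c.abs) (Set.mem_image_of_mem _ hy)
  have hM0 : 0 ≤ M := (abs_nonneg _).trans (hM 0 (by simp))
  have hC0 : 0 ≤ C := add_nonneg (by positivity) (integral_nonneg fun _ => abs_nonneg _)
  set P : Measure ℝ := volume.restrict (Set.Icc 0 1)
  set w : ℝ → ENNReal := fun y => ENNReal.ofReal (g' y ^ 2)
  have hgm : AEMeasurable g P := hgc.aemeasurable measurableSet_Icc
  have hg'm : AEMeasurable g' P := hg'c.aemeasurable measurableSet_Icc
  have hwm : AEMeasurable w P := (hg'm.pow_const 2).ennreal_ofReal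
  have hgm' : AEMeasurable g (P.withDensity w) := hgm.mono_ac (withDensity_absolutelyContinuous _ _)
  have hfin : IsFiniteMeasure (P.withDensity w) :=
    isFiniteMeasure_withDensity_ofReal
      ((hg'c.pow 2).integrableOn_compact isCompact_Icc).2
  have hpush {k : ℝ → ℝ} (hk : Measurable k) (hk0 : ∀ z, 0 ≤ k z) :
      ∫⁻ z, ENNReal.ofReal (k z) ∂((P.withDensity w).map g) =
        ∫⁻ y, ENNReal.ofReal (k (g y) * g' y ^ 2) ∂P := by
    have hkg : AEMeasurable (fun y => ENNReal.ofReal (k (g y))) P :=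
      (hk.comp_aemeasurable hgm).ennreal_ofReal
    rw [lintegral_map' hk.ennreal_ofReal.aemeasurable hgm',
      lintegral_withDensity_eq_lintegral_mul₀ hwm hkg]
    refine lintegral_congr fun y => ?_
    simp only [Pi.mul_apply, w]
    rw [mul_comm, ENNReal.ofReal_mul (hk0 _)]
  have hle : (P.withDensity w).map g ≤ C.toNNReal • volume.restrict (Set.Icc a b) := by
    refine Measure.le_of_forall_lintegral_le fun φ => ?_
    have hφ : Continuous fun z => (φ z : ℝ) := by fun_prop
    have key := integral_comp_mul_deriv_sq_le zero_le_one hg' hg'' hg''c hM hrange hφ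
      fun z => (φ z).2
    rw [intervalIntegral.integral_of_le zero_le_one, intervalIntegral.integral_of_le zero_le_one,
      intervalIntegral.integral_of_le hab.le, ← integral_Icc_eq_integral_Ioc,
      ← integral_Icc_eq_integral_Ioc, ← integral_Icc_eq_integral_Ioc, ← hC] at key
    have hL := hpush hφ.measurable fun z => (φ z).2
    simp only [ENNReal.ofReal_coe_nnreal] at hL
    have hint : Integrable (fun y => (φ (g y) : ℝ) * g' y ^ 2) P :=
      ((hφ.comp_continuousOn hgc).mul (hg'c.pow 2)).integrableOn_compact isCompact_Icc
    rw [hL, lintegral_smul_measure, ← ofReal_integral_eq_lintegral_ofReal hint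
      (Filter.Eventually.of_forall fun y => mul_nonneg (φ (g y)).2 (sq_nonneg _)),
      lintegral_coe_eq_integral _ (hφ.continuousOn.integrableOn_compact isCompact_Icc)]
    refine (ENNReal.ofReal_le_ofReal key).trans_eq ?_
    rw [ENNReal.ofReal_mul hC0]
    rfl
  have hlin : ∫⁻ y, ENNReal.ofReal (f (g y) ^ 2 * g' y ^ 2) ∂P ≤
      ENNReal.ofReal (C * ∫ z in Set.Icc a b, f z ^ 2) := by
    rw [← hpush (hf.pow_const 2) fun z => sq_nonneg _]
    refine (lintegral_mono' hle le_rfl).trans_eq ?_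
    rw [lintegral_smul_measure, ENNReal.ofReal_mul hC0, ofReal_integral_eq_lintegral_ofReal hf2
      (Filter.Eventually.of_forall fun z => sq_nonneg _)]
    rfl
  have hmeas : AEMeasurable (fun y => f (g y) ^ 2 * g' y ^ 2) P :=
    ((hf.comp_aemeasurable hgm).pow_const 2).mul (hg'm.pow_const 2)
  rw [integral_eq_lintegral_of_nonneg_ae
    (Filter.Eventually.of_forall fun y => mul_nonneg (sq_nonneg _) (sq_nonneg _))
    hmeas.aestronglyMeasurable]
  exact ENNReal.toReal_le_of_le_ofReal
    (mul_nonneg hC0 (integral_nonneg fun z => sq_nonneg _)) hlin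
end

section
/- Let d ≥ 2, let F: ℝ → ℝ be continuously differentiable with F'(z) ≠ 0 for all z, let m_1,…,m_d: [0,1] → ℝ be continuously differentiable, and define H(x_1,…,x_d) = F[m_1(x_1)+⋯+m_d(x_d)] with partial derivatives H_l = ∂H/∂x_l. Fix j with 2 ≤ j ≤ d, fix 0 ≤ a_1 < b_1 ≤ 1 with m_1'(x_1) ≠ 0 for all x_1 ∈ [a_1, b_1], and fix values x_2,…,x_{j−1}, x_{j+1},…,x_d ∈ [0,1] of the remaining coordinates. Then for every x_j ∈ [0,1], ∫_0^{x_j} ∫_{a_1}^{b_1} [H_j / H_1](x_1, x_2, …, x_{j−1}, u_j, x_{j+1}, …, x_d) dx_1 du_j = ( ∫_{a_1}^{b_1} m_1'(x_1)⁻¹ dx_1 ) · ( m_j(x_j) − m_j(0) ). -/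
noncomputable section

/-- The `l`-th partial derivative of `H(x) = F[m₁(x₁)+⋯+m_d(x_d)]` at `x`. -/
def Hpartial (d : ℕ) (F : ℝ → ℝ) (m : Fin d → ℝ → ℝ) (l : Fin d) (x : Fin d → ℝ) : ℝ :=
  deriv (fun t => F (∑ r, m r (Function.update x l t r))) (x l)

/-- Chain rule for `F[m₁(x₁)+⋯+m_d(x_d)]`. -/
theorem Hpartial_eq_deriv_mul_deriv {d : ℕ} {F : ℝ → ℝ} {m : Fin d → ℝ → ℝ}
    (hF : Differentiable ℝ F) (l : Fin d) (hm : Differentiable ℝ (m l)) (x : Fin d → ℝ) :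
    Hpartial d F m l x = deriv F (∑ r, m r (x r)) * deriv (m l) (x l) := by
  have hsum : HasDerivAt (fun t => ∑ r, m r (Function.update x l t r))
      (∑ r, if r = l then deriv (m l) (x l) else 0) (x l) := by
    refine HasDerivAt.fun_sum fun r _ => ?_
    by_cases h : r = l
    · subst h
      simpa using (hm (x r)).hasDerivAt
    · simpa [h] using hasDerivAt_const (x l) (m r (x r))
  rw [Finset.sum_ite_eq' Finset.univ l, if_pos (Finset.mem_univ l)] at hsum
  have hcomp := (hF (∑ r, m r (Function.update x l (x l) r))).hasDerivAt.comp (x l) hsum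
  rw [Function.update_eq_self] at hcomp
  exact hcomp.deriv

/-- The factor `F'` cancels in the ratio of two partial derivatives. -/
theorem Hpartial_div_Hpartial {d : ℕ} {F : ℝ → ℝ} {m : Fin d → ℝ → ℝ}
    (hF : Differentiable ℝ F) (hF' : ∀ z, deriv F z ≠ 0) (hm : ∀ l, Differentiable ℝ (m l))
    (k l : Fin d) (x : Fin d → ℝ) :
    Hpartial d F m k x / Hpartial d F m l x = deriv (m k) (x k) / deriv (m l) (x l) := by
  rw [Hpartial_eq_deriv_mul_deriv hF k (hm k), Hpartial_eq_deriv_mul_deriv hF l (hm l),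
    mul_div_mul_left _ _ (hF' _)]

/-- Equations (50)–(51) in Step 4 of the proof of Theorem 3.2: the double integral of `H_j/H_1`
recovers `m_j` up to the constant factor `ρ = ∫_{a₁}^{b₁} dx₁/m₁'(x₁)` and the additive
constant `m_j(0)`. -/
theorem component_recovery_identity
    (d : ℕ) (hd : 2 ≤ d)
    (F : ℝ → ℝ) (hF : ContDiff ℝ 1 F) (hF' : ∀ z : ℝ, deriv F z ≠ 0)
    (m : Fin d → ℝ → ℝ) (hm : ∀ j, ContDiff ℝ 1 (m j))
    (j : Fin d) (hj : j ≠ ⟨0, by omega⟩)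
    (a₁ b₁ : ℝ) (ha₁ : 0 ≤ a₁) (hab : a₁ < b₁) (hb₁ : b₁ ≤ 1)
    (hm1 : ∀ x ∈ Set.Icc a₁ b₁, deriv (m ⟨0, by omega⟩) x ≠ 0)
    (xo : Fin d → ℝ) (hxo : ∀ l, xo l ∈ Set.Icc (0 : ℝ) 1)
    (xj : ℝ) (hxj : xj ∈ Set.Icc (0 : ℝ) 1) :
    (∫ uj in (0 : ℝ)..xj, ∫ x₁ in a₁..b₁,
        Hpartial d F m j (Function.update (Function.update xo ⟨0, by omega⟩ x₁) j uj) /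
          Hpartial d F m ⟨0, by omega⟩
            (Function.update (Function.update xo ⟨0, by omega⟩ x₁) j uj))
      = (∫ x₁ in a₁..b₁, (deriv (m ⟨0, by omega⟩) x₁)⁻¹) * (m j xj - m j 0) := by
  have hm' : ∀ l, Differentiable ℝ (m l) := fun l => (hm l).differentiable one_ne_zero
  simp only [Hpartial_div_Hpartial (hF.differentiable one_ne_zero) hF' hm',
    Function.update_self, Function.update_of_ne hj.symm, div_eq_mul_inv,
    intervalIntegral.integral_const_mul, intervalIntegral.integral_mul_const]
  rw [intervalIntegral.integral_deriv_eq_sub (fun x _ => hm' j x)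
    (((hm j).continuous_deriv le_rfl).intervalIntegrable 0 xj), mul_comm]
end
end
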